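/- arXiv:1503.08559 — 4 statements merged into one kernel-verified Lean document; each statement's English description precedes it below -/
import Mathlib

section
/- Let γ, β : ℝ → ℝ be continuous with 0 < β(ξ) ≤ γ(ξ) for all ξ, and suppose there exists α > 0 such that sup_{|ξ| ≥ N} β(ξ)/γ(ξ) > α for every N > 0. Then there exists a sequence (u_n) of Schwartz functions with |u_n|_γ ≤ 1 for all n and |u_n − u_m|_β² ≥ α for all n ≠ m; in particular (u_n) is bounded in the |·|_γ seminorm but has no subsequence that is Cauchy in the |·|_β seminorm (the embedding H_γ ↪ H_β is not compact). -/
open MeasureTheory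

/-- Fourier transform with the convention `û(ξ) = ∫ u(x) e^{-iξx} dx`. -/
noncomputable def FT (u : ℝ → ℂ) (ξ : ℝ) : ℂ :=
  ∫ x : ℝ, u x * Complex.exp (-(Complex.I * (ξ : ℂ) * (x : ℂ)))

open scoped FourierTransform ContDiff

theorem FT_eq_fourier (u : SchwartzMap ℝ ℂ) (ξ : ℝ) :
    FT u ξ = (𝓕 u : SchwartzMap ℝ ℂ) (ξ / (2 * Real.pi)) := by
  rw [SchwartzMap.fourier_coe, Real.fourier_real_eq_integral_exp_smul, FT]
  congr 1
  ext x
  rw [smul_eq_mul, mul_comm]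
  congr 2
  have hpi : (Real.pi : ℂ) ≠ 0 := by exact_mod_cast Real.pi_ne_zero
  push_cast
  field_simp

theorem FT_sub (u v : SchwartzMap ℝ ℂ) (ξ : ℝ) :
    FT (u - v : SchwartzMap ℝ ℂ) ξ = FT u ξ - FT v ξ := by
  rw [FT_eq_fourier, FT_eq_fourier, FT_eq_fourier, sub_eq_add_neg u v,
    FourierTransform.fourier_add, FourierTransform.fourier_neg, ← sub_eq_add_neg, sub_apply]

theorem exists_schwartzMap_FT_eq {φ : ℝ → ℂ} (hc : HasCompactSupport φ) (hs : ContDiff ℝ ∞ φ) :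
    ∃ u : SchwartzMap ℝ ℂ, ∀ ξ, FT u ξ = φ ξ := by
  have h2 : 2 * Real.pi ≠ 0 := by positivity
  have hc' : HasCompactSupport fun t ↦ φ (2 * Real.pi * t) :=
    hc.comp_homeomorph (Homeomorph.mulLeft₀ _ h2)
  have hs' : ContDiff ℝ ∞ fun t ↦ φ (2 * Real.pi * t) := by fun_prop
  refine ⟨𝓕⁻ (hc'.toSchwartzMap hs'), fun ξ ↦ ?_⟩
  rw [FT_eq_fourier, FourierTransform.fourier_fourierInv_eq]
  change φ (2 * Real.pi * (ξ / (2 * Real.pi))) = φ ξ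
  rw [mul_div_cancel₀ ξ h2]

/-- In every nonempty open interval there lives a smooth bump normalized in `L²(γ)`. -/
theorem exists_bump_integral_mul_sq_eq_one {γ : ℝ → ℝ} (hγ : Continuous γ) (hpos : ∀ ξ, 0 < γ ξ)
    {a b : ℝ} (hab : a < b) :
    ∃ φ : ℝ → ℝ, HasCompactSupport φ ∧ ContDiff ℝ ∞ φ ∧ Function.support φ ⊆ Set.Ioo a b ∧
      ∫ ξ, γ ξ * φ ξ ^ 2 = 1 := by
  let f : ContDiffBump ((a + b) / 2) := ⟨(b - a) / 4, (b - a) / 2, by linarith, by linarith⟩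
  have hI : 0 < ∫ ξ, γ ξ * f ξ ^ 2 := by
    refine Continuous.integral_pos_of_hasCompactSupport_nonneg_nonzero (x := (a + b) / 2)
      (hγ.mul (f.continuous.pow 2)) ?_ (fun ξ ↦ mul_nonneg (hpos ξ).le (sq_nonneg _)) ?_
    · exact f.hasCompactSupport.mono fun ξ hξ h0 ↦ hξ (by simp [h0])
    · exact mul_ne_zero (hpos _).ne'
        (pow_ne_zero _ (f.pos_of_mem_ball (Metric.mem_ball_self f.rOut_pos)).ne')
  refine ⟨fun ξ ↦ (√(∫ ξ, γ ξ * f ξ ^ 2))⁻¹ * f ξ, f.hasCompactSupport.mul_left,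
    contDiff_const.mul f.contDiff, fun ξ hξ ↦ ?_, ?_⟩
  · have h1 : ξ ∈ Function.support f := fun h0 ↦ hξ (by simp [h0])
    rw [f.support_eq, Real.ball_eq_Ioo] at h1
    change ξ ∈ Set.Ioo ((a + b) / 2 - (b - a) / 2) ((a + b) / 2 + (b - a) / 2) at h1
    constructor <;> linarith [h1.1, h1.2]
  · have h1 (ξ : ℝ) : γ ξ * ((√(∫ ξ, γ ξ * f ξ ^ 2))⁻¹ * f ξ) ^ 2
        = (∫ ξ, γ ξ * f ξ ^ 2)⁻¹ * (γ ξ * f ξ ^ 2) := by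
      rw [mul_pow, inv_pow, Real.sq_sqrt hI.le]
      ring
    simp_rw [h1]
    rw [integral_const_mul, inv_mul_cancel₀ hI.ne']

/-- If the ratio `β/γ` does not tend to `0` at infinity (i.e. `sup_{|ξ| ≥ N} β/γ > α > 0` for
every `N > 0`), then there is a sequence of Schwartz functions bounded by `1` in the `|·|_γ`
seminorm whose mutual `|·|_β`-distances squared are at least `α`: the embedding
`H_γ ↪ H_β` is not compact. -/
theorem stmt_2 (γ β : ℝ → ℝ) (hγ : Continuous γ) (hβ : Continuous β)
    (h : ∀ ξ : ℝ, 0 < β ξ ∧ β ξ ≤ γ ξ) (α : ℝ) (hα : 0 < α)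
    (hsup : ∀ N : ℝ, 0 < N → α < sSup {r : ℝ | ∃ ξ : ℝ, N ≤ |ξ| ∧ β ξ / γ ξ = r}) :
    ∃ u : ℕ → SchwartzMap ℝ ℂ,
      (∀ n : ℕ, Real.sqrt (∫ ξ : ℝ, γ ξ * ‖FT (⇑(u n)) ξ‖ ^ 2) ≤ 1) ∧
      ∀ n m : ℕ, n ≠ m → α ≤ ∫ ξ : ℝ, β ξ * ‖FT (⇑(u n - u m)) ξ‖ ^ 2 := by
  have hne : {r : ℝ | ∃ ξ : ℝ, 1 ≤ |ξ| ∧ β ξ / γ ξ = r}.Nonempty := ⟨_, 1, by simp, rfl⟩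
  obtain ⟨_, ⟨ξ₀, -, rfl⟩, hξ₀⟩ := exists_lt_of_lt_csSup hne (hsup 1 one_pos)
  have hpos (ξ : ℝ) : 0 < γ ξ := (h ξ).1.trans_le (h ξ).2
  rw [lt_div_iff₀ (hpos ξ₀)] at hξ₀
  have hU : IsOpen {ξ | α * γ ξ < β ξ} := isOpen_lt (by fun_prop) hβ
  obtain ⟨ε, hε, hball⟩ := Metric.isOpen_iff.1 hU ξ₀ hξ₀
  rw [Real.ball_eq_Ioo] at hball
  obtain ⟨x, hx, hxmem, -⟩ := exists_seq_strictMono_tendsto' (show ξ₀ - ε < ξ₀ + ε by linarith)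
  choose φ hc hs hsupp hint using fun n ↦
    exists_bump_integral_mul_sq_eq_one hγ hpos (hx (Nat.lt_succ_self n))
  have hgood (n : ℕ) (ξ : ℝ) (hξ : φ n ξ ≠ 0) : α * γ ξ < β ξ :=
    hball ⟨(hxmem n).1.trans (hsupp n hξ).1, (hsupp n hξ).2.trans (hxmem _).2⟩
  have hdisj (n m : ℕ) (hnm : n ≠ m) (ξ : ℝ) (hξ : φ n ξ ≠ 0) : φ m ξ = 0 := by
    by_contra hm
    exact Set.disjoint_left.1 (hx.monotone.pairwise_disjoint_on_Ioo_succ hnm)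
      (hsupp n hξ) (hsupp m hm)
  choose u hu using fun n ↦ exists_schwartzMap_FT_eq (φ := fun ξ ↦ (φ n ξ : ℂ))
    ((hc n).comp_left Complex.ofReal_zero) (Complex.ofRealCLM.contDiff.comp (hs n))
  refine ⟨u, fun n ↦ ?_, fun n m hnm ↦ ?_⟩
  · simp [hu, hint]
  · have hnorm (ξ : ℝ) : ‖FT (u n - u m : SchwartzMap ℝ ℂ) ξ‖ ^ 2 = (φ n ξ - φ m ξ) ^ 2 := by
      rw [FT_sub, hu, hu, ← Complex.ofReal_sub, Complex.norm_real, Real.norm_eq_abs, sq_abs]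
    simp_rw [hnorm]
    calc α = ∫ ξ, α * (γ ξ * φ n ξ ^ 2) := by rw [integral_const_mul, hint, mul_one]
      _ ≤ ∫ ξ, β ξ * (φ n ξ - φ m ξ) ^ 2 := by
        refine integral_mono ?_ ?_ fun ξ ↦ ?_
        · refine Continuous.integrable_of_hasCompactSupport
            (continuous_const.mul (hγ.mul ((hs n).continuous.pow 2)))
            ((hc n).mono fun ξ hξ h0 ↦ hξ (by simp [h0]))
        · exact Continuous.integrable_of_hasCompactSupport
            (hβ.mul (((hs n).continuous.sub (hs m).continuous).pow 2))
            (((hc n).sub (hc m)).mono fun ξ hξ h0 ↦ hξ (by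
              have h0' : φ n ξ - φ m ξ = 0 := h0
              simp [h0']))
        · by_cases hξ : φ n ξ = 0
          · simpa [hξ] using mul_nonneg (h ξ).1.le (sq_nonneg (φ m ξ))
          · simp only [hdisj n m hnm ξ hξ, sub_zero, ← mul_assoc]
            exact mul_le_mul_of_nonneg_right (hgood n ξ hξ).le (sq_nonneg _)
end

section
/- Let u be a smooth solution of the damped generalized KdV equation ∂_t u + ∂_x u + ∂_x³ u + uᵖ ∂_x u + L_γ(u) = 0 on [0,T) × ℝ with u(0,·) = u₀, and define the energy E(v) := (1/2) ∫_ℝ (∂_x v)² dx − (1/((p+1)(p+2))) ∫_ℝ v^{p+2} dx. Then for every t ∈ [0,T): E(u(t,·)) + ∫₀ᵗ (1/(2π)) ∫_ℝ γ(ξ) |(∂_x u(τ,·))^(ξ)|² dξ dτ − (1/(p+1)) ∫₀ᵗ ∫_ℝ L_γ(u(τ,·))(x) · u(τ,x)^{p+1} dx dτ = E(u₀). -/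
open MeasureTheory

/-- Fourier transform with the convention `û(ξ) = ∫ u(x) e^{-iξx} dx`. -/
noncomputable def FTc (f : ℝ → ℂ) (ξ : ℝ) : ℂ :=
  ∫ x : ℝ, f x * Complex.exp (-(Complex.I * (ξ : ℂ) * (x : ℂ)))

/-- Fourier transform of a real-valued function. -/
noncomputable def FTr (f : ℝ → ℝ) (ξ : ℝ) : ℂ :=
  FTc (fun x => (f x : ℂ)) ξ

/-- The damping operator `L_γ(f)(x) = (1/(2π)) ∫ γ(ξ) f̂(ξ) e^{iξx} dξ` (for a real-valued
function `f` the integral is real, and we take the real part). -/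
noncomputable def Ldamp (γ : ℝ → ℝ) (f : ℝ → ℝ) (x : ℝ) : ℝ :=
  (1 / (2 * Real.pi)) *
    (∫ ξ : ℝ, (γ ξ : ℂ) * FTr f ξ * Complex.exp (Complex.I * (ξ : ℂ) * (x : ℂ))).re

/-- A real function is Schwartz: smooth with all seminorms `sup |x|^k |f^{(n)}(x)|` finite. -/
def IsSchwartzFn (f : ℝ → ℝ) : Prop :=
  ContDiff ℝ (⊤ : ℕ∞) f ∧ ∀ k n : ℕ, ∃ C : ℝ, ∀ x : ℝ, |x| ^ k * |iteratedDeriv n f x| ≤ C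

/-- `γ` is polynomially bounded. -/
def PolyBounded (γ : ℝ → ℝ) : Prop :=
  ∃ (C : ℝ) (n : ℕ), ∀ ξ : ℝ, |γ ξ| ≤ C * (1 + |ξ|) ^ n

/-- A smooth solution of the damped generalized KdV equation
`∂ₜu + ∂ₓu + ∂ₓ³u + uᵖ ∂ₓu + L_γ(u) = 0` on `[0,T) × ℝ`: `u` is smooth, `u(t,·)` and
`∂ₜu(t,·)` are Schwartz for each `t ∈ [0,T)` with all Schwartz seminorms locally bounded in
`t`, and the equation holds pointwise. -/
def IsSmoothSolution (p : ℕ) (γ : ℝ → ℝ) (T : ℝ) (u : ℝ → ℝ → ℝ) : Prop :=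
  ContDiffOn ℝ (⊤ : ℕ∞) (Function.uncurry u) (Set.Ico 0 T ×ˢ Set.univ) ∧
  (∀ t ∈ Set.Ico (0 : ℝ) T,
    IsSchwartzFn (u t) ∧ IsSchwartzFn (fun x => deriv (fun τ => u τ x) t)) ∧
  (∀ (k n : ℕ) (K : Set ℝ), IsCompact K → K ⊆ Set.Ico (0 : ℝ) T →
    ∃ B : ℝ, ∀ t ∈ K, ∀ x : ℝ,
      |x| ^ k * |iteratedDeriv n (u t) x| ≤ B ∧
      |x| ^ k * |iteratedDeriv n (fun y => deriv (fun τ => u τ y) t) x| ≤ B) ∧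
  (∀ t ∈ Set.Ico (0 : ℝ) T, ∀ x : ℝ,
    deriv (fun τ => u τ x) t + deriv (u t) x + iteratedDeriv 3 (u t) x
      + (u t x) ^ p * deriv (u t) x + Ldamp γ (u t) x = 0)

/-- The energy `E(v) = (1/2)∫ (∂ₓv)² - (1/((p+1)(p+2))) ∫ v^{p+2}`. -/
noncomputable def energy (p : ℕ) (v : ℝ → ℝ) : ℝ :=
  (1 / 2) * (∫ x : ℝ, (deriv v x) ^ 2) -
    (1 / (((p : ℝ) + 1) * ((p : ℝ) + 2))) * ∫ x : ℝ, (v x) ^ (p + 2)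

open Set
open scoped FourierTransform ContDiff

section Fourier

theorem FTr_eq_fourier (f : ℝ → ℝ) (ξ : ℝ) :
    FTr f ξ = 𝓕 (fun x => (f x : ℂ)) (ξ / (2 * Real.pi)) := by
  rw [Real.fourier_real_eq_integral_exp_smul, FTr, FTc]
  congr 1
  ext x
  rw [smul_eq_mul, mul_comm]
  congr 2
  have : (Real.pi : ℂ) ≠ 0 := by exact_mod_cast Real.pi_ne_zero
  push_cast
  field_simp

theorem IsSchwartzFn.deriv {f : ℝ → ℝ} (hf : IsSchwartzFn f) : IsSchwartzFn (deriv f) := by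
  refine ⟨(contDiff_infty_iff_deriv.1 hf.1).2, fun k n => ?_⟩
  simpa only [← iteratedDeriv_succ'] using hf.2 k (n + 1)

theorem abs_le_mul_inv_one_add_sq {a x B C : ℝ} (h0 : |a| ≤ B) (h2 : |x| ^ 2 * |a| ≤ C) :
    |a| ≤ (B + C) * (1 + x ^ 2)⁻¹ := by
  rw [← div_eq_mul_inv, le_div_iff₀ (by positivity)]
  rw [sq_abs] at h2
  linarith

theorem IsSchwartzFn.integrable {f : ℝ → ℝ} (hf : IsSchwartzFn f) : Integrable f := by
  obtain ⟨B, hB⟩ := hf.2 0 0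
  obtain ⟨C, hC⟩ := hf.2 2 0
  refine (integrable_inv_one_add_sq.const_mul (B + C)).mono'
    hf.1.continuous.aestronglyMeasurable (.of_forall fun x => ?_)
  exact abs_le_mul_inv_one_add_sq (by simpa using hB x) (by simpa using hC x)

/-- The complexification of a real Schwartz function, as a bundled Schwartz map. -/
noncomputable def IsSchwartzFn.toSchwartzMap {f : ℝ → ℝ} (hf : IsSchwartzFn f) :
    SchwartzMap ℝ ℂ :=
  SchwartzMap.postcompCLM Complex.ofRealCLM
    { toFun := f
      smooth' := hf.1
      decay' := fun k n => by
        simpa only [norm_iteratedFDeriv_eq_norm_iteratedDeriv, Real.norm_eq_abs] using hf.2 k n }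

theorem FTr_continuous {f : ℝ → ℝ} (hf : IsSchwartzFn f) : Continuous (FTr f) := by
  have h : FTr f = fun ξ => (𝓕 hf.toSchwartzMap) (ξ / (2 * Real.pi)) := by
    ext1 ξ
    rw [FTr_eq_fourier, SchwartzMap.fourier_coe]
    rfl
  rw [h]
  exact (𝓕 hf.toSchwartzMap).continuous.comp (by fun_prop)

theorem FTr_decay {f : ℝ → ℝ} (hf : IsSchwartzFn f) (m : ℕ) :
    ∃ D, ∀ ξ : ℝ, (1 + |ξ|) ^ m * ‖FTr f ξ‖ ≤ D := by
  refine ⟨(2 * Real.pi) ^ m * (2 ^ m * ((Finset.Iic (m, 0)).sup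
    fun m => SchwartzMap.seminorm ℝ m.1 m.2) (𝓕 hf.toSchwartzMap)), fun ξ => ?_⟩
  have h := SchwartzMap.one_add_le_sup_seminorm_apply (𝕜 := ℝ) (m := (m, 0)) le_rfl le_rfl
    (𝓕 hf.toSchwartzMap) (ξ / (2 * Real.pi))
  have hE : FTr f ξ = (𝓕 hf.toSchwartzMap) (ξ / (2 * Real.pi)) := by
    rw [FTr_eq_fourier, SchwartzMap.fourier_coe]
    rfl
  rw [norm_iteratedFDeriv_zero, ← hE] at h
  have hpi := Real.pi_gt_three
  have h1 : 1 + |ξ| ≤ 2 * Real.pi * (1 + ‖ξ / (2 * Real.pi)‖) := by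
    rw [Real.norm_eq_abs, abs_div, abs_of_pos (by positivity : 0 < 2 * Real.pi), mul_add,
      mul_div_cancel₀ _ (by positivity)]
    linarith
  calc (1 + |ξ|) ^ m * ‖FTr f ξ‖
      ≤ (2 * Real.pi * (1 + ‖ξ / (2 * Real.pi)‖)) ^ m * ‖FTr f ξ‖ := by gcongr
    _ = (2 * Real.pi) ^ m * ((1 + ‖ξ / (2 * Real.pi)‖) ^ m * ‖FTr f ξ‖) := by
        rw [mul_pow, mul_assoc]
    _ ≤ _ := by gcongr

theorem integrable_mul_FTr {γ : ℝ → ℝ} (hmeas : Measurable γ) (hpoly : PolyBounded γ)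
    {f : ℝ → ℝ} (hf : IsSchwartzFn f) : Integrable fun ξ => (γ ξ : ℂ) * FTr f ξ := by
  obtain ⟨C, n, hC⟩ := hpoly
  obtain ⟨D, hD⟩ := FTr_decay hf (n + 2)
  refine (integrable_inv_one_add_sq.const_mul (|C| * D)).mono'
    ((Complex.measurable_ofReal.comp hmeas).aestronglyMeasurable.mul
      (FTr_continuous hf).aestronglyMeasurable) (.of_forall fun ξ => ?_)
  rw [← div_eq_mul_inv, le_div_iff₀ (by positivity), norm_mul, Complex.norm_real,
    Real.norm_eq_abs]
  have h1 : 1 + ξ ^ 2 ≤ (1 + |ξ|) ^ 2 := by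
    nlinarith [abs_nonneg ξ, sq_abs ξ]
  calc |γ ξ| * ‖FTr f ξ‖ * (1 + ξ ^ 2)
      ≤ (|C| * (1 + |ξ|) ^ n) * ‖FTr f ξ‖ * (1 + |ξ|) ^ 2 := by
        gcongr
        exact (hC ξ).trans (by gcongr; exact le_abs_self C)
    _ = |C| * ((1 + |ξ|) ^ (n + 2) * ‖FTr f ξ‖) := by ring
    _ ≤ _ := by gcongr; exact hD ξ

theorem FTr_deriv {f : ℝ → ℝ} (hf : IsSchwartzFn f) (ξ : ℝ) :
    FTr (deriv f) ξ = Complex.I * ξ * FTr f ξ := by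
  have hd : Differentiable ℝ f := (contDiff_infty_iff_deriv.1 hf.1).1
  have hder : deriv (fun x => (f x : ℂ)) = fun x => ((deriv f x : ℝ) : ℂ) :=
    funext fun x => (hd x).hasDerivAt.ofReal_comp.deriv
  have h := Real.fourier_deriv (f := fun x => (f x : ℂ)) hf.integrable.ofReal
    (fun x => (hd x).hasDerivAt.ofReal_comp.differentiableAt)
    (by rw [hder]; exact hf.deriv.integrable.ofReal)
  rw [FTr_eq_fourier, FTr_eq_fourier, ← hder, h]
  simp only [smul_eq_mul]
  have : (Real.pi : ℂ) ≠ 0 := by exact_mod_cast Real.pi_ne_zero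
  push_cast
  field_simp

theorem conj_FTr (g : ℝ → ℝ) (ξ : ℝ) :
    (starRingEnd ℂ) (FTr g ξ)
      = ∫ x : ℝ, Complex.exp (Complex.I * (ξ : ℂ) * (x : ℂ)) * (g x : ℂ) := by
  rw [FTr, FTc, ← integral_conj]
  congr 1
  ext x
  rw [map_mul, ← Complex.exp_conj, mul_comm]
  simp

/-- Parseval's identity for the damping operator. -/
theorem integral_Ldamp_mul {γ : ℝ → ℝ} (hmeas : Measurable γ) (hpoly : PolyBounded γ)
    {f g : ℝ → ℝ} (hf : IsSchwartzFn f) (hg : Integrable g) :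
    ∫ x, Ldamp γ f x * g x = (1 / (2 * Real.pi)) *
      (∫ ξ, (γ ξ : ℂ) * FTr f ξ * (starRingEnd ℂ) (FTr g ξ)).re := by
  have hF := integrable_mul_FTr hmeas hpoly hf
  have hprod : Integrable (Function.uncurry fun (x ξ : ℝ) => (γ ξ : ℂ) * FTr f ξ *
      Complex.exp (Complex.I * (ξ : ℂ) * (x : ℂ)) * (g x : ℂ)) (volume.prod volume) := by
    have hgC : Integrable fun x => (g x : ℂ) := hg.ofReal
    have h := hgC.mul_prod hF
    refine h.mono ?_ (.of_forall fun z => ?_)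
    · have he : Continuous fun z : ℝ × ℝ => Complex.exp (Complex.I * (z.2 : ℂ) * (z.1 : ℂ)) := by
        fun_prop
      refine (h.aestronglyMeasurable.mul he.aestronglyMeasurable).congr (.of_forall fun z => ?_)
      simp only [Function.uncurry, Pi.mul_apply]
      ring
    · have he : ‖Complex.exp (Complex.I * (z.2 : ℂ) * (z.1 : ℂ))‖ = 1 := by
        rw [mul_assoc, mul_comm, ← Complex.ofReal_mul]
        exact Complex.norm_exp_ofReal_mul_I _
      simp only [Function.uncurry, norm_mul, he, mul_one]
      exact (mul_comm _ _).le
  have hswap := integral_integral_swap hprod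
  simp only [mul_assoc, integral_const_mul] at hswap
  simp only [← conj_FTr, ← mul_assoc] at hswap
  rw [← hswap]
  have hre := integral_re (𝕜 := ℂ) hprod.integral_prod_left
  simp only [Function.uncurry, integral_mul_const] at hre
  simp only [integral_mul_const]
  rw [show ∀ z : ℂ, z.re = RCLike.re z from fun _ => rfl, ← hre, ← integral_const_mul]
  congr 1
  ext x
  simp [Ldamp, mul_assoc]

/-- The dissipation of the damping operator at the level of the first derivative. -/
theorem integral_Ldamp_mul_deriv_deriv {γ : ℝ → ℝ} (hmeas : Measurable γ)
    (hpoly : PolyBounded γ) {f : ℝ → ℝ} (hf : IsSchwartzFn f) :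
    ∫ x, Ldamp γ f x * deriv (deriv f) x
      = -((1 / (2 * Real.pi)) * ∫ ξ, γ ξ * ‖FTr (deriv f) ξ‖ ^ 2) := by
  rw [integral_Ldamp_mul hmeas hpoly hf hf.deriv.deriv.integrable, ← mul_neg, ← integral_neg]
  congr 1
  have h : ∀ ξ, (γ ξ : ℂ) * FTr f ξ * (starRingEnd ℂ) (FTr (deriv (deriv f)) ξ)
      = ((-(γ ξ * ‖FTr (deriv f) ξ‖ ^ 2) : ℝ) : ℂ) := fun ξ => by
    rw [FTr_deriv hf.deriv, FTr_deriv hf]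
    push_cast
    rw [← Complex.mul_conj']
    simp only [map_mul, Complex.conj_I, Complex.conj_ofReal]
    ring
  simp only [h, integral_complex_ofReal, Complex.ofReal_re]

end Fourier

section Decay

/-- A family `F τ` of continuous functions, continuous in the parameter `τ ∈ s` and bounded by a
fixed multiple of `1 / (1 + x ^ 2)`. -/
structure UniformlyDecaying (s : Set ℝ) (F : ℝ → ℝ → ℝ) : Prop where
  continuousOn : ∀ x, ContinuousOn (fun τ => F τ x) s
  continuous : ∀ τ ∈ s, Continuous (F τ)
  bound : ∃ C, ∀ τ ∈ s, ∀ x, |F τ x| ≤ C * (1 + x ^ 2)⁻¹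

namespace UniformlyDecaying

variable {s : Set ℝ} {F G : ℝ → ℝ → ℝ}

theorem congr (hF : UniformlyDecaying s F) (h : ∀ τ ∈ s, ∀ x, G τ x = F τ x) :
    UniformlyDecaying s G where
  continuousOn x := (hF.continuousOn x).congr fun τ hτ => h τ hτ x
  continuous τ hτ := by rw [funext (h τ hτ)]; exact hF.continuous τ hτ
  bound := hF.bound.imp fun C hC τ hτ x => by rw [h τ hτ x]; exact hC τ hτ x

theorem mono {r : Set ℝ} (hF : UniformlyDecaying s F) (h : r ⊆ s) : UniformlyDecaying r F where
  continuousOn x := (hF.continuousOn x).mono h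
  continuous τ hτ := hF.continuous τ (h hτ)
  bound := hF.bound.imp fun _ hC τ hτ => hC τ (h hτ)

theorem add (hF : UniformlyDecaying s F) (hG : UniformlyDecaying s G) :
    UniformlyDecaying s (fun τ x => F τ x + G τ x) where
  continuousOn x := (hF.continuousOn x).add (hG.continuousOn x)
  continuous τ hτ := (hF.continuous τ hτ).add (hG.continuous τ hτ)
  bound := by
    obtain ⟨C, hC⟩ := hF.bound
    obtain ⟨D, hD⟩ := hG.bound
    refine ⟨C + D, fun τ hτ x => (abs_add_le _ _).trans ?_⟩
    rw [add_mul]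
    exact add_le_add (hC τ hτ x) (hD τ hτ x)

theorem const_mul (c : ℝ) (hF : UniformlyDecaying s F) :
    UniformlyDecaying s (fun τ x => c * F τ x) where
  continuousOn x := (hF.continuousOn x).const_mul c
  continuous τ hτ := (hF.continuous τ hτ).const_mul c
  bound := by
    obtain ⟨C, hC⟩ := hF.bound
    refine ⟨|c| * C, fun τ hτ x => ?_⟩
    rw [abs_mul, mul_assoc]
    exact mul_le_mul_of_nonneg_left (hC τ hτ x) (abs_nonneg c)

theorem mul (hF : UniformlyDecaying s F) (hG : UniformlyDecaying s G) :
    UniformlyDecaying s (fun τ x => F τ x * G τ x) where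
  continuousOn x := (hF.continuousOn x).mul (hG.continuousOn x)
  continuous τ hτ := (hF.continuous τ hτ).mul (hG.continuous τ hτ)
  bound := by
    obtain ⟨C, hC⟩ := hF.bound
    obtain ⟨D, hD⟩ := hG.bound
    refine ⟨|C| * |D|, fun τ hτ x => ?_⟩
    have hw : (1 + x ^ 2)⁻¹ ≤ 1 := inv_le_one_of_one_le₀ (by nlinarith [sq_nonneg x])
    have hw0 : 0 ≤ (1 + x ^ 2)⁻¹ := by positivity
    have h1 : |F τ x| ≤ |C| * (1 + x ^ 2)⁻¹ :=
      (hC τ hτ x).trans (by gcongr; exact le_abs_self C)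
    have h2 : |G τ x| ≤ |D| :=
      (hD τ hτ x).trans ((mul_le_mul_of_nonneg_right (le_abs_self D) hw0).trans
        (mul_le_of_le_one_right (abs_nonneg D) hw))
    rw [abs_mul]
    calc |F τ x| * |G τ x| ≤ (|C| * (1 + x ^ 2)⁻¹) * |D| := by gcongr
      _ = _ := by ring

theorem pow_succ (hF : UniformlyDecaying s F) (n : ℕ) :
    UniformlyDecaying s (fun τ x => F τ x ^ (n + 1)) := by
  induction n with
  | zero => simpa using hF
  | succ n ih => exact (ih.mul hF).congr fun τ _ x => _root_.pow_succ _ _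

theorem integrable (hF : UniformlyDecaying s F) {τ : ℝ} (hτ : τ ∈ s) : Integrable (F τ) := by
  obtain ⟨C, hC⟩ := hF.bound
  exact (integrable_inv_one_add_sq.const_mul C).mono' (hF.continuous τ hτ).aestronglyMeasurable
    (.of_forall (hC τ hτ))

theorem continuousOn_integral (hF : UniformlyDecaying s F) :
    ContinuousOn (fun τ => ∫ x, F τ x) s := by
  obtain ⟨C, hC⟩ := hF.bound
  exact continuousOn_of_dominated (fun τ hτ => (hF.continuous τ hτ).aestronglyMeasurable)
    (fun τ hτ => .of_forall (hC τ hτ)) (integrable_inv_one_add_sq.const_mul C)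
    (.of_forall hF.continuousOn)

theorem intervalIntegrable {t : ℝ} (ht : 0 ≤ t) (hF : UniformlyDecaying (Ioo 0 t) F) :
    IntervalIntegrable (fun τ => ∫ x, F τ x) volume 0 t := by
  rw [intervalIntegrable_iff_integrableOn_Ioo_of_le ht]
  have hm := hF.continuousOn_integral.aestronglyMeasurable (μ := volume) measurableSet_Ioo
  obtain ⟨C, hC⟩ := hF.bound
  refine ⟨hm, HasFiniteIntegral.restrict_of_bounded (∫ x, C * (1 + x ^ 2)⁻¹) (by simp) ?_⟩
  filter_upwards [ae_restrict_mem measurableSet_Ioo] with τ hτ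
  exact norm_integral_le_of_norm_le (integrable_inv_one_add_sq.const_mul C)
    (.of_forall (hC τ hτ))

theorem hasDerivAt_integral (hs : IsOpen s) (hF : UniformlyDecaying s F)
    (hG : UniformlyDecaying s G) (h : ∀ τ ∈ s, ∀ x, HasDerivAt (fun σ => F σ x) (G τ x) τ)
    {τ : ℝ} (hτ : τ ∈ s) : HasDerivAt (fun σ => ∫ x, F σ x) (∫ x, G τ x) τ := by
  obtain ⟨C, hC⟩ := hG.bound
  have hn := hs.mem_nhds hτ
  refine (hasDerivAt_integral_of_dominated_loc_of_deriv_le (F := F) (F' := G) hn ?_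
    (hF.integrable hτ) (hG.continuous τ hτ).aestronglyMeasurable
    (.of_forall fun x σ hσ => hC σ hσ x) (integrable_inv_one_add_sq.const_mul C)
    (.of_forall fun x σ hσ => h σ hσ x)).2
  filter_upwards [hn] with σ hσ using (hF.continuous σ hσ).aestronglyMeasurable

end UniformlyDecaying

end Decay

section PartialDerivatives

variable {s : Set ℝ} {u : ℝ → ℝ → ℝ}

theorem ContDiffOn.deriv_snd (hs : UniqueDiffOn ℝ s)
    (hu : ContDiffOn ℝ ∞ (Function.uncurry u) (s ×ˢ univ)) :
    ContDiffOn ℝ ∞ (Function.uncurry fun τ => deriv (u τ)) (s ×ˢ univ) := by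
  have hU : UniqueDiffOn ℝ (s ×ˢ (univ : Set ℝ)) := hs.prod uniqueDiffOn_univ
  refine ((hu.fderivWithin hU (m := ∞) le_rfl).clm_apply
    (contDiffOn_const (c := ((0 : ℝ), (1 : ℝ))))).congr fun z hz => ?_
  have h1 := ((hu.differentiableOn (by simp)) z hz).hasFDerivWithinAt
  have h2 : HasDerivWithinAt (fun y : ℝ => (z.1, y)) ((0 : ℝ), (1 : ℝ)) univ z.2 :=
    ((hasDerivAt_const z.2 z.1).prodMk (hasDerivAt_id z.2)).hasDerivWithinAt
  have h3 := h1.comp_hasDerivWithinAt (f := fun y : ℝ => (z.1, y)) z.2 h2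
    fun y _ => ⟨hz.1, mem_univ y⟩
  exact (hasDerivWithinAt_univ.1 h3).deriv

theorem ContDiffOn.continuousOn_uncurry_left
    (hu : ContDiffOn ℝ ∞ (Function.uncurry u) (s ×ˢ univ)) (x : ℝ) :
    ContinuousOn (fun τ => u τ x) s :=
  hu.continuousOn.comp (f := fun τ : ℝ => (τ, x)) (by fun_prop) fun τ hτ => ⟨hτ, mem_univ x⟩

theorem ContDiffOn.hasDerivAt_fst (hs : IsOpen s)
    (hu : ContDiffOn ℝ ∞ (Function.uncurry u) (s ×ˢ univ)) {τ : ℝ} (hτ : τ ∈ s) (x : ℝ) :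
    HasDerivAt (fun σ => u σ x) (fderiv ℝ (Function.uncurry u) (τ, x) (1, 0)) τ := by
  have h := ((hu.contDiffAt ((hs.prod isOpen_univ).mem_nhds
    (⟨hτ, mem_univ x⟩ : (τ, x) ∈ s ×ˢ univ))).differentiableAt (by simp)).hasFDerivAt
  exact h.comp_hasDerivAt (f := fun σ : ℝ => (σ, x)) τ
    ((hasDerivAt_id τ).prodMk (hasDerivAt_const τ x))

theorem ContDiffOn.hasDerivAt_snd (hs : IsOpen s)
    (hu : ContDiffOn ℝ ∞ (Function.uncurry u) (s ×ˢ univ)) {τ : ℝ} (hτ : τ ∈ s) (x : ℝ) :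
    HasDerivAt (u τ) (fderiv ℝ (Function.uncurry u) (τ, x) (0, 1)) x := by
  have h := ((hu.contDiffAt ((hs.prod isOpen_univ).mem_nhds
    (⟨hτ, mem_univ x⟩ : (τ, x) ∈ s ×ˢ univ))).differentiableAt (by simp)).hasFDerivAt
  exact h.comp_hasDerivAt (f := fun y : ℝ => (τ, y)) x
    ((hasDerivAt_const x τ).prodMk (hasDerivAt_id x))

theorem ContDiffOn.deriv_fst (hs : IsOpen s)
    (hu : ContDiffOn ℝ ∞ (Function.uncurry u) (s ×ˢ univ)) :
    ContDiffOn ℝ ∞ (Function.uncurry fun τ x => deriv (fun σ => u σ x) τ) (s ×ˢ univ) :=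
  ((hu.fderiv_of_isOpen (hs.prod isOpen_univ) (m := ∞) le_rfl).clm_apply
    (contDiffOn_const (c := ((1 : ℝ), (0 : ℝ))))).congr
    fun z hz => (hu.hasDerivAt_fst hs hz.1 z.2).deriv

/-- The mixed partial derivatives of a smooth function agree. -/
theorem ContDiffOn.hasDerivAt_deriv_comm (hs : IsOpen s)
    (hu : ContDiffOn ℝ ∞ (Function.uncurry u) (s ×ˢ univ)) {τ : ℝ} (hτ : τ ∈ s) (x : ℝ) :
    HasDerivAt (fun σ => deriv (u σ) x) (deriv (fun y => deriv (fun σ => u σ y) τ) x) τ := by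
  have hz : (τ, x) ∈ s ×ˢ (univ : Set ℝ) := ⟨hτ, mem_univ x⟩
  have hn := (hs.prod isOpen_univ).mem_nhds hz
  have hfd := (((hu.fderiv_of_isOpen (hs.prod isOpen_univ) (m := ∞) le_rfl).contDiffAt
    hn).differentiableAt (by simp)).hasFDerivAt
  have hsymm : IsSymmSndFDerivAt ℝ (Function.uncurry u) (τ, x) :=
    (hu.contDiffAt hn).isSymmSndFDerivAt (by
      rw [minSmoothness_of_isRCLikeNormedField]
      exact WithTop.coe_le_coe.2 (le_top : (2 : ℕ∞) ≤ ⊤))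
  have h1 := (hfd.comp_hasDerivAt (f := fun σ : ℝ => (σ, x)) τ
    ((hasDerivAt_id τ).prodMk (hasDerivAt_const τ x))).clm_apply
    (hasDerivAt_const τ ((0 : ℝ), (1 : ℝ)))
  have h2 := (hfd.comp_hasDerivAt (f := fun y : ℝ => (τ, y)) x
    ((hasDerivAt_const x τ).prodMk (hasDerivAt_id x))).clm_apply
    (hasDerivAt_const x ((1 : ℝ), (0 : ℝ)))
  rw [funext fun y => (hu.hasDerivAt_fst hs hτ y).deriv]
  have h2' := h2.deriv
  simp only [Function.comp_def, map_zero, add_zero] at h1 h2'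
  rw [h2', ← hsymm (1, 0) (0, 1)]
  refine h1.congr_of_eventuallyEq ?_
  filter_upwards [hs.mem_nhds hτ] with σ hσ using (hu.hasDerivAt_snd hs hσ x).deriv

end PartialDerivatives

section Energy

theorem UniformlyDecaying.of_contDiffOn {s : Set ℝ} {F : ℝ → ℝ → ℝ}
    (hF : ContDiffOn ℝ ∞ (Function.uncurry F) (s ×ˢ univ))
    (hb : ∀ k : ℕ, ∃ B, ∀ τ ∈ s, ∀ x : ℝ, |x| ^ k * |F τ x| ≤ B) : UniformlyDecaying s F where
  continuousOn x := hF.continuousOn_uncurry_left x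
  continuous τ hτ := by
    refine continuousOn_univ.1 (hF.continuousOn.comp (f := fun x : ℝ => (τ, x)) (by fun_prop) ?_)
    exact fun x hx => ⟨hτ, hx⟩
  bound := by
    obtain ⟨B, hB⟩ := hb 0
    obtain ⟨C, hC⟩ := hb 2
    exact ⟨B + C, fun τ hτ x =>
      abs_le_mul_inv_one_add_sq (by simpa using hB τ hτ x) (hC τ hτ x)⟩

theorem IsSchwartzFn.uniformlyDecaying {f : ℝ → ℝ} (hf : IsSchwartzFn f) :
    UniformlyDecaying univ fun _ => f :=
  .of_contDiffOn (hf.1.comp contDiff_snd).contDiffOn fun k => (hf.2 k 0).imp fun B hB _ _ x => by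
    simpa using hB x

/-- The rate of change of the energy along the equation, with `g` in the role of the time
derivative and `L` in the role of the damping term. -/
theorem energy_rate (p : ℕ) {f g L : ℝ → ℝ} (hf : IsSchwartzFn f) (hg : IsSchwartzFn g)
    (h : ∀ x, g x + deriv f x + deriv (deriv (deriv f)) x + f x ^ p * deriv f x + L x = 0) :
    (∫ x, deriv f x * deriv g x) - 1 / ((p : ℝ) + 1) * ∫ x, f x ^ (p + 1) * g x
      = (∫ x, L x * deriv (deriv f) x) + 1 / ((p : ℝ) + 1) * ∫ x, L x * f x ^ (p + 1) := by
  have D0 := hf.uniformlyDecaying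
  have D1 := hf.deriv.uniformlyDecaying
  have D2 := hf.deriv.deriv.uniformlyDecaying
  have D3 := hf.deriv.deriv.deriv.uniformlyDecaying
  have E0 := hg.uniformlyDecaying
  have E1 := hg.deriv.uniformlyDecaying
  have hW := D2.add ((D0.pow_succ p).const_mul (1 / ((p : ℝ) + 1)))
  have hpow : UniformlyDecaying univ fun _ x => f x ^ p * deriv f x := by
    cases p with
    | zero => simpa using D1
    | succ n => exact (D0.pow_succ n).mul D1
  have hL : UniformlyDecaying univ fun _ => L :=
    ((((E0.add D1).add D3).add hpow).const_mul (-1)).congr fun _ _ x => by linarith [h x]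
  have hflux := (((D1.mul E0).add ((hW.mul hW).const_mul (1 / 2))).add
    ((D1.mul D1).const_mul (1 / 2))).add
      ((D0.pow_succ (p + 1)).const_mul (1 / (((p : ℝ) + 1) * ((p : ℝ) + 2))))
  have i1 := (D1.mul E1).integrable (mem_univ 0)
  have i2 := (((D0.pow_succ p).mul E0).integrable (mem_univ 0)).const_mul (1 / ((p : ℝ) + 1))
  have i3 := (hL.mul D2).integrable (mem_univ 0)
  have i4 := ((hL.mul (D0.pow_succ p)).integrable (mem_univ 0)).const_mul (1 / ((p : ℝ) + 1))
  have hp1 : (p : ℝ) + 1 ≠ 0 := by positivity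
  have hp2 : (p : ℝ) + 2 ≠ 0 := by positivity
  have hder := integral_eq_zero_of_hasDerivAt_of_integrable
    (f' := fun x => (deriv f x * deriv g x - 1 / ((p : ℝ) + 1) * (f x ^ (p + 1) * g x))
      - (L x * deriv (deriv f) x + 1 / ((p : ℝ) + 1) * (L x * f x ^ (p + 1))))
    (fun x => ?_) ((i1.sub i2).sub (i3.add i4)) (hflux.integrable (mem_univ 0))
  · have hsplit := integral_sub (i1.sub i2) (i3.add i4)
    simp only [Pi.sub_apply, Pi.add_apply] at hsplit
    rw [hsplit, integral_sub i1 i2, integral_add i3 i4,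
      integral_const_mul, integral_const_mul] at hder
    linarith
  · have d : ∀ {φ : ℝ → ℝ}, IsSchwartzFn φ → HasDerivAt φ (deriv φ x) x := fun hφ =>
      ((contDiff_infty_iff_deriv.1 hφ.1).1 x).hasDerivAt
    have d0 := d hf
    have d1 := d hf.deriv
    have dW := (d hf.deriv.deriv).add ((d0.pow (p + 1)).const_mul (1 / ((p : ℝ) + 1)))
    refine ((((d1.mul (d hg)).add ((dW.mul dW).const_mul (1 / 2))).add
      ((d1.mul d1).const_mul (1 / 2))).add
      ((d0.pow (p + 1 + 1)).const_mul (1 / (((p : ℝ) + 1) * ((p : ℝ) + 2))))).congr_deriv ?_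
    have hLx : L x = -(g x + deriv f x + deriv (deriv (deriv f)) x + f x ^ p * deriv f x) := by
      linarith [h x]
    simp only [Pi.add_apply, Pi.pow_apply, hLx, add_tsub_cancel_right]
    push_cast
    field_simp
    ring

end Energy

/-- Energy balance law: along a smooth solution of the damped generalized KdV equation,
`E(u(t)) + ∫₀ᵗ (1/(2π)) ∫ γ(ξ)|(∂ₓu(τ))^(ξ)|² dξ dτ
  - (1/(p+1)) ∫₀ᵗ ∫ L_γ(u(τ))(x) u(τ,x)^{p+1} dx dτ = E(u₀)`. -/
theorem stmt_10 (p : ℕ) (hp : 1 ≤ p) (γ : ℝ → ℝ) (hmeas : Measurable γ)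
    (hnn : ∀ ξ : ℝ, 0 ≤ γ ξ) (hpoly : PolyBounded γ) (T : ℝ) (hT : 0 < T)
    (u : ℝ → ℝ → ℝ) (hu : IsSmoothSolution p γ T u) :
    ∀ t ∈ Set.Ico (0 : ℝ) T,
      energy p (u t) +
          (∫ τ in (0 : ℝ)..t, (1 / (2 * Real.pi)) * ∫ ξ : ℝ, γ ξ * ‖FTr (deriv (u τ)) ξ‖ ^ 2) -
          (1 / ((p : ℝ) + 1)) *
            ∫ τ in (0 : ℝ)..t, ∫ x : ℝ, Ldamp γ (u τ) x * (u τ x) ^ (p + 1)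
        = energy p (u 0) := by
  obtain ⟨hsm, hsch, hbd, hpde⟩ := hu
  intro t ht
  have hsub : Icc 0 t ⊆ Ico 0 T := fun τ hτ => ⟨hτ.1, hτ.2.trans_lt ht.2⟩
  have hIoo : Ioo 0 t ⊆ Icc 0 t := Ioo_subset_Icc_self
  have hopen : ContDiffOn ℝ ∞ (Function.uncurry u) (Ioo 0 t ×ˢ univ) :=
    hsm.mono (prod_mono (hIoo.trans hsub) le_rfl)
  have hsmn : ∀ n, ContDiffOn ℝ ∞ (Function.uncurry fun τ => iteratedDeriv n (u τ))
      (Ico 0 T ×ˢ univ) := fun n => by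
    induction n with
    | zero => simpa only [iteratedDeriv_zero] using hsm
    | succ n ih => simpa only [iteratedDeriv_succ] using ih.deriv_snd (uniqueDiffOn_Ico 0 T)
  have hU : ∀ n, UniformlyDecaying (Icc 0 t) fun τ => iteratedDeriv n (u τ) := fun n =>
    .of_contDiffOn ((hsmn n).mono (prod_mono hsub le_rfl)) fun k =>
      (hbd k n _ isCompact_Icc hsub).imp fun B hB τ hτ x => (hB τ hτ x).1
  have U0 : UniformlyDecaying (Icc 0 t) u := by simpa only [iteratedDeriv_zero] using hU 0
  have U1 : UniformlyDecaying (Icc 0 t) fun τ => deriv (u τ) := by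
    simpa only [iteratedDeriv_one] using hU 1
  have h2 : ∀ τ, iteratedDeriv 2 (u τ) = deriv (deriv (u τ)) := fun τ => by
    rw [iteratedDeriv_succ, iteratedDeriv_one]
  have h3 : ∀ τ, iteratedDeriv 3 (u τ) = deriv (deriv (deriv (u τ))) := fun τ => by
    rw [iteratedDeriv_succ, h2]
  have U2 : UniformlyDecaying (Icc 0 t) fun τ => deriv (deriv (u τ)) := by
    simpa only [h2] using hU 2
  have V0 : UniformlyDecaying (Ioo 0 t) fun τ x => deriv (fun σ => u σ x) τ :=
    .of_contDiffOn (hopen.deriv_fst isOpen_Ioo) fun k =>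
      (hbd k 0 _ isCompact_Icc hsub).imp fun B hB τ hτ x => by
        simpa using (hB τ (hIoo hτ) x).2
  have V1 : UniformlyDecaying (Ioo 0 t) fun τ => deriv fun y => deriv (fun σ => u σ y) τ :=
    .of_contDiffOn ((hopen.deriv_fst isOpen_Ioo).deriv_snd (uniqueDiffOn_Ioo 0 t)) fun k =>
      (hbd k 1 _ isCompact_Icc hsub).imp fun B hB τ hτ x => by
        simpa only [iteratedDeriv_one] using (hB τ (hIoo hτ) x).2
  have hpow : UniformlyDecaying (Icc 0 t) fun τ x => u τ x ^ p * deriv (u τ) x := by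
    obtain ⟨n, rfl⟩ := Nat.exists_eq_succ_of_ne_zero (Nat.one_le_iff_ne_zero.1 hp)
    exact (U0.pow_succ n).mul U1
  have hL : UniformlyDecaying (Ioo 0 t) fun τ => Ldamp γ (u τ) :=
    ((((V0.add (U1.mono hIoo)).add ((hU 3).mono hIoo)).add (hpow.mono hIoo)).const_mul
      (-1)).congr fun τ hτ x => by linarith [hpde τ (hsub (hIoo hτ)) x]
  have hcont : ContinuousOn (fun τ => energy p (u τ)) (Icc 0 t) :=
    ((U1.pow_succ 1).continuousOn_integral.const_mul _).sub
      ((U0.pow_succ (p + 1)).continuousOn_integral.const_mul _)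
  have hp1 : (p : ℝ) + 1 ≠ 0 := by positivity
  have hp2 : (p : ℝ) + 2 ≠ 0 := by positivity
  have hderiv : ∀ τ ∈ Ioo 0 t, HasDerivAt (fun σ => energy p (u σ))
      ((∫ x, Ldamp γ (u τ) x * deriv (deriv (u τ)) x)
        + 1 / ((p : ℝ) + 1) * ∫ x, Ldamp γ (u τ) x * u τ x ^ (p + 1)) τ := fun τ hτ => by
    have hS := hsch τ (hsub (hIoo hτ))
    rw [← energy_rate p hS.1 hS.2 fun x => by rw [← h3]; exact hpde τ (hsub (hIoo hτ)) x]
    have e1 := ((U1.pow_succ 1).mono hIoo).hasDerivAt_integral isOpen_Ioo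
      (((U1.mono hIoo).mul V1).const_mul 2) (fun σ hσ x => by
        refine ((hopen.hasDerivAt_deriv_comm isOpen_Ioo hσ x).pow 2).congr_deriv ?_
        simp only [Nat.cast_ofNat, Nat.add_one_sub_one, pow_one]
        ring) hτ
    have e2 := ((U0.pow_succ (p + 1)).mono hIoo).hasDerivAt_integral isOpen_Ioo
      ((((U0.pow_succ p).mono hIoo).mul V0).const_mul ((p : ℝ) + 2)) (fun σ hσ x => by
        refine ((hopen.hasDerivAt_fst isOpen_Ioo hσ x).pow (p + 1 + 1)).congr_deriv ?_
        rw [(hopen.hasDerivAt_fst isOpen_Ioo hσ x).deriv]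
        simp only [add_tsub_cancel_right]
        push_cast
        ring) hτ
    refine ((e1.const_mul (1 / 2)).sub
      (e2.const_mul (1 / (((p : ℝ) + 1) * ((p : ℝ) + 2))))).congr_deriv ?_
    rw [integral_const_mul, integral_const_mul]
    field_simp
  have j1 := UniformlyDecaying.intervalIntegrable ht.1 (hL.mul (U2.mono hIoo))
  have j2 := (UniformlyDecaying.intervalIntegrable ht.1
    (hL.mul ((U0.pow_succ p).mono hIoo))).const_mul (1 / ((p : ℝ) + 1))
  have hftc := intervalIntegral.integral_eq_sub_of_hasDerivAt_of_le ht.1 hcont hderiv (j1.add j2)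
  rw [intervalIntegral.integral_add j1 j2, intervalIntegral.integral_const_mul,
    intervalIntegral.integral_congr (g := fun τ =>
      -((1 / (2 * Real.pi)) * ∫ ξ : ℝ, γ ξ * ‖FTr (deriv (u τ)) ξ‖ ^ 2)) fun τ hτ => ?_,
    intervalIntegral.integral_neg] at hftc
  · linarith
  · rw [uIcc_of_le ht.1] at hτ
    exact integral_Ldamp_mul_deriv_deriv hmeas hpoly (hsch τ (hsub hτ)).1
end

section
/- Let p ≥ 1 be an integer and let u : ℝ → ℝ be a Schwartz function. Then − ∫_ℝ u(x)^p u'(x) u''''(x) dx = − (5p/2) ∫_ℝ u(x)^{p−1} u'(x) (u''(x))² dx − p(p−1) ∫_ℝ u(x)^{p−2} (u'(x))³ u''(x) dx. -/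
open MeasureTheory

/-- A function of temperate growth times a Schwartz function is integrable. -/
lemma Function.HasTemperateGrowth.integrable_mul_schwartzMap {g : ℝ → ℝ}
    (hg : g.HasTemperateGrowth) (w : SchwartzMap ℝ ℝ) : Integrable fun x ↦ g x * w x := by
  refine (SchwartzMap.smulLeftCLM ℝ g w).integrable.congr (.of_forall fun x ↦ ?_)
  simp [SchwartzMap.smulLeftCLM_apply_apply hg]

/-- Iterated derivatives of a Schwartz function are Schwartz functions. -/
lemma SchwartzMap.exists_coe_eq_iteratedDeriv (u : SchwartzMap ℝ ℝ) (n : ℕ) :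
    ∃ v : SchwartzMap ℝ ℝ, ⇑v = iteratedDeriv n u := by
  induction n with
  | zero => exact ⟨u, iteratedDeriv_zero.symm⟩
  | succ n ih =>
    obtain ⟨v, hv⟩ := ih
    refine ⟨SchwartzMap.derivCLM ℝ ℝ v, ?_⟩
    ext x
    rw [SchwartzMap.derivCLM_apply, iteratedDeriv_succ, hv]

/-- Integration by parts identity: for an integer `p ≥ 1` and a real Schwartz function `u`,
`-∫ uᵖ u' u'''' = -(5p/2) ∫ u^{p-1} u' (u'')² - p(p-1) ∫ u^{p-2} (u')³ u''`
(for `p = 1` the last term has coefficient `0`). -/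
theorem stmt_13 (p : ℕ) (hp : 1 ≤ p) (u : SchwartzMap ℝ ℝ) :
    -(∫ x : ℝ, (u x) ^ p * deriv (⇑u) x * iteratedDeriv 4 (⇑u) x)
      = -(5 * (p : ℝ) / 2) *
          (∫ x : ℝ, (u x) ^ (p - 1) * deriv (⇑u) x * (iteratedDeriv 2 (⇑u) x) ^ 2)
        - (p : ℝ) * ((p : ℝ) - 1) *
          ∫ x : ℝ, (u x) ^ (p - 2) * (deriv (⇑u) x) ^ 3 * iteratedDeriv 2 (⇑u) x := by
  obtain ⟨b, hb⟩ := u.exists_coe_eq_iteratedDeriv 1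
  obtain ⟨c, hc⟩ := u.exists_coe_eq_iteratedDeriv 2
  obtain ⟨d, hd⟩ := u.exists_coe_eq_iteratedDeriv 3
  obtain ⟨e, he⟩ := u.exists_coe_eq_iteratedDeriv 4
  have hu' (x) : HasDerivAt u (b x) x := by
    simpa [hb, iteratedDeriv_one] using u.hasDerivAt x
  have hb' (x) : HasDerivAt b (c x) x := by
    rw [hc, iteratedDeriv_succ, ← hb]; exact b.hasDerivAt x
  have hc' (x) : HasDerivAt c (d x) x := by
    rw [hd, iteratedDeriv_succ, ← hc]; exact c.hasDerivAt x
  have hd' (x) : HasDerivAt d (e x) x := by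
    rw [he, iteratedDeriv_succ, ← hd]; exact d.hasDerivAt x
  rw [← iteratedDeriv_one, ← hb, ← hc, ← he]
  have tu := u.hasTemperateGrowth
  have tb := b.hasTemperateGrowth
  have tc := c.hasTemperateGrowth
  have i₁ : Integrable fun x ↦ u x ^ p * b x * e x :=
    Function.HasTemperateGrowth.integrable_mul_schwartzMap (by fun_prop) e
  have i₂ : Integrable fun x ↦ u x ^ (p - 1) * b x * c x ^ 2 := by
    simpa only [pow_two, mul_assoc] using
      Function.HasTemperateGrowth.integrable_mul_schwartzMap
        (g := fun x ↦ u x ^ (p - 1) * b x * c x) (by fun_prop) c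
  have i₃ : Integrable fun x ↦ u x ^ (p - 2) * b x ^ 3 * c x :=
    Function.HasTemperateGrowth.integrable_mul_schwartzMap (by fun_prop) c
  have j₁ : Integrable fun x ↦ u x ^ p * b x * d x :=
    Function.HasTemperateGrowth.integrable_mul_schwartzMap (by fun_prop) d
  have j₂ : Integrable fun x ↦ u x ^ p * c x * c x :=
    Function.HasTemperateGrowth.integrable_mul_schwartzMap (by fun_prop) c
  have j₃ : Integrable fun x ↦ u x ^ (p - 1) * b x ^ 2 * c x :=
    Function.HasTemperateGrowth.integrable_mul_schwartzMap (by fun_prop) c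
  have key := integral_eq_zero_of_hasDerivAt_of_integrable
    (f := fun x ↦ u x ^ p * b x * d x - 1 / 2 * (u x ^ p * c x * c x)
      - p * (u x ^ (p - 1) * b x ^ 2 * c x))
    (f' := fun x ↦ u x ^ p * b x * e x - 5 * p / 2 * (u x ^ (p - 1) * b x * c x ^ 2)
      - p * (p - 1) * (u x ^ (p - 2) * b x ^ 3 * c x))
    (fun x ↦ by
      convert (((((hu' x).fun_pow p).fun_mul (hb' x)).fun_mul (hd' x)).fun_sub
        (((((hu' x).fun_pow p).fun_mul (hc' x)).fun_mul (hc' x)).const_mul (1 / 2 : ℝ))).fun_sub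
        (((((hu' x).fun_pow (p - 1)).fun_mul ((hb' x).fun_pow 2)).fun_mul (hc' x)).const_mul
          (p : ℝ)) using 1
      rw [Nat.sub_sub, Nat.cast_sub hp]
      push_cast
      ring)
    ((i₁.sub (i₂.const_mul _)).sub (i₃.const_mul _))
    ((j₁.sub (j₂.const_mul _)).sub (j₃.const_mul _))
  rw [integral_sub ?_ (i₃.const_mul _),
    integral_sub i₁ (i₂.const_mul _), integral_const_mul, integral_const_mul] at key
  · linarith
  · exact i₁.sub (i₂.const_mul _)
end

section
/- Let p ≥ 1 be an integer and let u : ℝ → ℝ be a Schwartz function. Then − ∫_ℝ u^p u' u'''' dx ≤ (5p/2) ‖u‖_{L^∞}^{p−1} ‖u'‖_{L^∞} ‖u''‖²_{L²} + p(p−1) ‖u‖_{L^∞}^{p−2} ‖u'‖²_{L^∞} ‖u'‖_{L²} ‖u''‖_{L²}. -/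
open MeasureTheory

open scoped BoundedContinuousFunction

theorem SchwartzMap.integrable_boundedContinuousFunction_mul (f : ℝ →ᵇ ℝ) (g : SchwartzMap ℝ ℝ) :
    Integrable fun x => f x * g x :=
  g.integrable.bdd_mul f.continuous.aestronglyMeasurable
    (Filter.Eventually.of_forall f.norm_coe_le_norm)

theorem SchwartzMap.abs_le_iSup_abs (f : SchwartzMap ℝ ℝ) (x : ℝ) : |f x| ≤ ⨆ y, |f y| :=
  le_ciSup (f := fun y => |f y|)
    ⟨SchwartzMap.seminorm ℝ 0 0 f, by rintro _ ⟨y, rfl⟩; exact f.norm_le_seminorm ℝ y⟩ x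

theorem SchwartzMap.hasDerivAt_derivCLM (f : SchwartzMap ℝ ℝ) (x : ℝ) :
    HasDerivAt f (SchwartzMap.derivCLM ℝ ℝ f x) x := by
  rw [SchwartzMap.derivCLM_apply]
  exact f.differentiableAt.hasDerivAt

/-- The Cauchy–Schwarz inequality for Schwartz functions. -/
theorem SchwartzMap.integral_abs_mul_le (f g : SchwartzMap ℝ ℝ) :
    ∫ x, |f x| * |g x| ≤ √(∫ x, f x ^ 2) * √(∫ x, g x ^ 2) := by
  have h := integral_mul_norm_le_Lp_mul_Lq (μ := volume) Real.HolderConjugate.two_two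
    (f.memLp (ENNReal.ofReal 2)) (g.memLp (ENNReal.ofReal 2))
  simpa [Real.sqrt_eq_rpow, Real.norm_eq_abs] using h

/-- If `v`, `w`, `z`, `y` are the successive derivatives of `u`, the integrand `uᵖ v y` differs
from lower-order terms by an exact derivative. -/
theorem hasDerivAt_pow_mul_energy {p : ℕ} (hp : 1 ≤ p) {u v w z : ℝ → ℝ} {y x : ℝ}
    (hu : HasDerivAt u (v x) x) (hv : HasDerivAt v (w x) x) (hw : HasDerivAt w (z x) x)
    (hz : HasDerivAt z y x) :
    HasDerivAt (fun x => u x ^ p * v x * z x - p * (u x ^ (p - 1) * v x ^ 2 * w x)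
        - 1 / 2 * (u x ^ p * w x * w x))
      (u x ^ p * v x * y - p * (p - 1) * (u x ^ (p - 2) * v x ^ 3 * w x)
        - 5 * p / 2 * (u x ^ (p - 1) * v x * w x * w x)) x := by
  convert! ((((hu.pow p).mul hv).mul hz).sub
    ((((hu.pow (p - 1)).mul (hv.pow 2)).mul hw).const_mul (p : ℝ))).sub
    ((((hu.pow p).mul hw).mul hw).const_mul (1 / 2 : ℝ)) using 1
  rw [Nat.cast_sub hp, show p - 1 - 1 = p - 2 by omega]
  simp only [Pi.mul_apply, Pi.pow_apply]
  push_cast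
  ring

theorem neg_energy_le {p : ℕ} (hp : 1 ≤ p) {a b c A B : ℝ} (ha : |a| ≤ A) (hb : |b| ≤ B) :
    -(p * (p - 1) * (a ^ (p - 2) * b ^ 3 * c) + 5 * p / 2 * (a ^ (p - 1) * b * c * c)) ≤
      p * (p - 1) * A ^ (p - 2) * B ^ 2 * (|b| * |c|) + 5 * p / 2 * A ^ (p - 1) * B * c ^ 2 := by
  have hp' : (1 : ℝ) ≤ p := by exact_mod_cast hp
  have hA : 0 ≤ A := (abs_nonneg a).trans ha
  have hB : 0 ≤ B := (abs_nonneg b).trans hb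
  have h₁ : -(a ^ (p - 2) * b ^ 3 * c) ≤ A ^ (p - 2) * B ^ 2 * (|b| * |c|) := by
    calc -(a ^ (p - 2) * b ^ 3 * c) ≤ |a ^ (p - 2) * b ^ 3 * c| := neg_le_abs _
      _ = |a| ^ (p - 2) * |b| ^ 2 * (|b| * |c|) := by
        rw [abs_mul, abs_mul, abs_pow, abs_pow]; ring
      _ ≤ _ := by gcongr
  have h₂ : -(a ^ (p - 1) * b * c * c) ≤ A ^ (p - 1) * B * c ^ 2 := by
    calc -(a ^ (p - 1) * b * c * c) ≤ |a ^ (p - 1) * b * c * c| := neg_le_abs _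
      _ = |a| ^ (p - 1) * |b| * c ^ 2 := by
        rw [abs_mul, abs_mul, abs_mul, abs_pow, ← sq_abs c]; ring
      _ ≤ _ := by gcongr
  have h₃ : (0 : ℝ) ≤ p * (p - 1) := mul_nonneg (by linarith) (by linarith)
  have h₄ : (0 : ℝ) ≤ 5 * p / 2 := by linarith
  linarith [mul_le_mul_of_nonneg_left h₁ h₃, mul_le_mul_of_nonneg_left h₂ h₄]

/-- For an integer `p ≥ 1` and a real Schwartz function `u`,
`-∫ uᵖ u' u'''' ≤ (5p/2) ‖u‖_∞^{p-1} ‖u'‖_∞ ‖u''‖_{L²}²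
  + p(p-1) ‖u‖_∞^{p-2} ‖u'‖_∞² ‖u'‖_{L²} ‖u''‖_{L²}`. -/
theorem stmt_14 (p : ℕ) (hp : 1 ≤ p) (u : SchwartzMap ℝ ℝ) :
    -(∫ x : ℝ, (u x) ^ p * deriv (⇑u) x * iteratedDeriv 4 (⇑u) x)
      ≤ (5 * (p : ℝ) / 2) * (⨆ x : ℝ, |u x|) ^ (p - 1) * (⨆ x : ℝ, |deriv (⇑u) x|) *
          (∫ x : ℝ, (iteratedDeriv 2 (⇑u) x) ^ 2)
        + (p : ℝ) * ((p : ℝ) - 1) * (⨆ x : ℝ, |u x|) ^ (p - 2) *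
            (⨆ x : ℝ, |deriv (⇑u) x|) ^ 2 *
            Real.sqrt (∫ x : ℝ, (deriv (⇑u) x) ^ 2) *
            Real.sqrt (∫ x : ℝ, (iteratedDeriv 2 (⇑u) x) ^ 2) := by
  obtain ⟨v, hv⟩ : ∃ v, v = SchwartzMap.derivCLM ℝ ℝ u := ⟨_, rfl⟩
  obtain ⟨w, hw⟩ : ∃ w, w = SchwartzMap.derivCLM ℝ ℝ v := ⟨_, rfl⟩
  obtain ⟨z, hz⟩ : ∃ z, z = SchwartzMap.derivCLM ℝ ℝ w := ⟨_, rfl⟩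
  obtain ⟨y, hy⟩ : ∃ y, y = SchwartzMap.derivCLM ℝ ℝ z := ⟨_, rfl⟩
  have hu' : deriv u = v := by ext x; rw [hv, SchwartzMap.derivCLM_apply]
  have hv' : deriv v = w := by ext x; rw [hw, SchwartzMap.derivCLM_apply]
  have hw' : deriv w = z := by ext x; rw [hz, SchwartzMap.derivCLM_apply]
  have hz' : deriv z = y := by ext x; rw [hy, SchwartzMap.derivCLM_apply]
  have h2 : iteratedDeriv 2 u = w := by
    simp only [iteratedDeriv_succ', hu', hv', iteratedDeriv_zero]
  have h4 : iteratedDeriv 4 u = y := by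
    simp only [iteratedDeriv_succ', hu', hv', hw', hz', iteratedDeriv_zero]
  rw [h2, h4, hu']
  set A := ⨆ x, |u x|
  set B := ⨆ x, |v x|
  let U := u.toBoundedContinuousFunction
  let V := v.toBoundedContinuousFunction
  let W := w.toBoundedContinuousFunction
  have int_uvy : Integrable fun x => u x ^ p * v x * y x :=
    SchwartzMap.integrable_boundedContinuousFunction_mul (U ^ p * V) y
  have int_uvz : Integrable fun x => u x ^ p * v x * z x :=
    SchwartzMap.integrable_boundedContinuousFunction_mul (U ^ p * V) z
  have int_uvvw : Integrable fun x => u x ^ (p - 1) * v x ^ 2 * w x :=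
    SchwartzMap.integrable_boundedContinuousFunction_mul (U ^ (p - 1) * V ^ 2) w
  have int_uww : Integrable fun x => u x ^ p * w x * w x :=
    SchwartzMap.integrable_boundedContinuousFunction_mul (U ^ p * W) w
  have int_uvvvw : Integrable fun x => u x ^ (p - 2) * v x ^ 3 * w x :=
    SchwartzMap.integrable_boundedContinuousFunction_mul (U ^ (p - 2) * V ^ 3) w
  have int_uvww : Integrable fun x => u x ^ (p - 1) * v x * w x * w x :=
    SchwartzMap.integrable_boundedContinuousFunction_mul (U ^ (p - 1) * V * W) w
  have int_vw : Integrable fun x => |v x| * |w x| := by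
    simpa only [V, SchwartzMap.toBoundedContinuousFunction_apply, abs_mul] using
      (SchwartzMap.integrable_boundedContinuousFunction_mul V w).abs
  have int_ww : Integrable fun x => w x ^ 2 := by
    simpa only [W, SchwartzMap.toBoundedContinuousFunction_apply, sq] using
      SchwartzMap.integrable_boundedContinuousFunction_mul W w
  have int_lower : Integrable fun x => p * (p - 1) * (u x ^ (p - 2) * v x ^ 3 * w x) +
      5 * p / 2 * (u x ^ (p - 1) * v x * w x * w x) :=
    (int_uvvvw.const_mul _).add (int_uvww.const_mul _)
  have hzero := integral_eq_zero_of_hasDerivAt_of_integrable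
    (fun x => hasDerivAt_pow_mul_energy hp (hv ▸ u.hasDerivAt_derivCLM x)
      (hw ▸ v.hasDerivAt_derivCLM x) (hz ▸ w.hasDerivAt_derivCLM x)
      (hy ▸ z.hasDerivAt_derivCLM x))
    ((int_uvy.sub (int_uvvvw.const_mul _)).sub (int_uvww.const_mul _))
    ((int_uvz.sub (int_uvvw.const_mul _)).sub (int_uww.const_mul _))
  have hparts : ∫ x, u x ^ p * v x * y x =
      ∫ x, (p * (p - 1) * (u x ^ (p - 2) * v x ^ 3 * w x) +
        5 * p / 2 * (u x ^ (p - 1) * v x * w x * w x)) := by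
    rw [← sub_eq_zero, ← integral_sub int_uvy int_lower, ← hzero]
    congr 1 with x
    ring
  have hp' : (1 : ℝ) ≤ p := by exact_mod_cast hp
  have hA : 0 ≤ A := (abs_nonneg _).trans (u.abs_le_iSup_abs 0)
  have hcoef : 0 ≤ p * (p - 1) * A ^ (p - 2) * B ^ 2 :=
    mul_nonneg (mul_nonneg (mul_nonneg (by linarith) (by linarith)) (by positivity)) (by positivity)
  calc -(∫ x, u x ^ p * v x * y x)
      ≤ ∫ x, (p * (p - 1) * A ^ (p - 2) * B ^ 2 * (|v x| * |w x|) +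
          5 * p / 2 * A ^ (p - 1) * B * w x ^ 2) := by
        rw [hparts, ← integral_neg]
        exact integral_mono int_lower.neg ((int_vw.const_mul _).add (int_ww.const_mul _))
          fun x => neg_energy_le hp (u.abs_le_iSup_abs x) (v.abs_le_iSup_abs x)
    _ = p * (p - 1) * A ^ (p - 2) * B ^ 2 * (∫ x, |v x| * |w x|) +
          5 * p / 2 * A ^ (p - 1) * B * ∫ x, w x ^ 2 := by
        rw [integral_add (int_vw.const_mul _) (int_ww.const_mul _), integral_const_mul,
          integral_const_mul]
    _ ≤ _ := by
        linarith [mul_le_mul_of_nonneg_left (v.integral_abs_mul_le w) hcoef]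
end
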